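/- arXiv:2503.16093 — 5 statements merged into one kernel-verified Lean document; each statement's English description precedes it below -/
import Mathlib

section
/- The weighted Cheeger constants with boundary-measure constraint and with combined constraint satisfy h̃_C ≤ h̄_C. -/
open MeasureTheory Set ENNReal

noncomputable section

/-- Weighted integral `∫_S w dμ`, valued in `[0,∞]`. -/
def wInt {d : ℕ} (μ : Measure (EuclideanSpace ℝ (Fin d)))
    (w : EuclideanSpace ℝ (Fin d) → ℝ) (S : Set (EuclideanSpace ℝ (Fin d))) : ℝ≥0∞ :=
  ∫⁻ x in S, ENNReal.ofReal (w x) ∂μ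

/-- `s`-dimensional Hausdorff measure on `ℝ^d`. -/
def Hm (d : ℕ) (s : ℝ) : Measure (EuclideanSpace ℝ (Fin d)) :=
  MeasureTheory.Measure.hausdorffMeasure s

/-- The surface measure `σ`: `(d-1)`-dimensional Hausdorff measure restricted to `∂Ω`. -/
def sigmaM (d : ℕ) (Om : Set (EuclideanSpace ℝ (Fin d))) : Measure (EuclideanSpace ℝ (Fin d)) :=
  (Hm d ((d : ℝ) - 1)).restrict (frontier Om)

/-- `|A|_α := ∫_A α dλ`. -/
def volW {d : ℕ} (α : EuclideanSpace ℝ (Fin d) → ℝ) (A : Set (EuclideanSpace ℝ (Fin d))) : ℝ≥0∞ :=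
  wInt volume α A

/-- `∫_S β dσ` for subsets of `∂Ω`. -/
def bdW {d : ℕ} (Om : Set (EuclideanSpace ℝ (Fin d))) (β : EuclideanSpace ℝ (Fin d) → ℝ)
    (S : Set (EuclideanSpace ℝ (Fin d))) : ℝ≥0∞ :=
  wInt (sigmaM d Om) β S

/-- Internal boundary `∂_I A := frontier A ∩ interior Ω`. -/
def intB {d : ℕ} (Om A : Set (EuclideanSpace ℝ (Fin d))) : Set (EuclideanSpace ℝ (Fin d)) :=
  frontier A ∩ interior Om

/-- External boundary `∂_E A := closure A ∩ ∂Ω`. -/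
def extB {d : ℕ} (Om A : Set (EuclideanSpace ℝ (Fin d))) : Set (EuclideanSpace ℝ (Fin d)) :=
  closure A ∩ frontier Om

/-- `|∂_I A|_α := ∫_{∂_I A} α dH^{d-1}`. -/
def intBW {d : ℕ} (Om : Set (EuclideanSpace ℝ (Fin d))) (α : EuclideanSpace ℝ (Fin d) → ℝ)
    (A : Set (EuclideanSpace ℝ (Fin d))) : ℝ≥0∞ :=
  wInt (Hm d ((d : ℝ) - 1)) α (intB Om A)

/-- `|∂_E A|_β := ∫_{∂_E A} β dσ`. -/
def extBW {d : ℕ} (Om : Set (EuclideanSpace ℝ (Fin d))) (β : EuclideanSpace ℝ (Fin d) → ℝ)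
    (A : Set (EuclideanSpace ℝ (Fin d))) : ℝ≥0∞ :=
  bdW Om β (extB Om A)

/-- Frontier of `S` in the subspace topology of `F`, as a subset of the ambient space:
`closure S ∩ closure (F \ S) ∩ F` (relative closure of `S` intersected with the
relative closure of its relative complement). -/
def relFrontier {X : Type*} [TopologicalSpace X] (F S : Set X) : Set X :=
  closure S ∩ closure (F \ S) ∩ F

/-- `|∂∂_E A|_β := ∫_{∂∂_E A} β dH^{d-2}`, where `∂∂_E A` is the frontier of `∂_E A` in the
subspace topology of `∂Ω`. -/
def ddEW {d : ℕ} (Om : Set (EuclideanSpace ℝ (Fin d))) (β : EuclideanSpace ℝ (Fin d) → ℝ)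
    (A : Set (EuclideanSpace ℝ (Fin d))) : ℝ≥0∞ :=
  wInt (Hm d ((d : ℝ) - 2)) β (relFrontier (frontier Om) (extB Om A))

/-- `A ⊆ Ω` is admissible if it is Borel and `∫_{closure A ∩ closure (Ω \ A) ∩ ∂Ω} β dσ = 0`. -/
def Admissible {d : ℕ} (Om : Set (EuclideanSpace ℝ (Fin d))) (β : EuclideanSpace ℝ (Fin d) → ℝ)
    (A : Set (EuclideanSpace ℝ (Fin d))) : Prop :=
  MeasurableSet A ∧ bdW Om β (closure A ∩ closure (Om \ A) ∩ frontier Om) = 0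

/-- `h_C`: volume constraint `0 < |A|_α ≤ |Ω|_α/2`. -/
def hC {d : ℕ} (Om : Set (EuclideanSpace ℝ (Fin d))) (α β : EuclideanSpace ℝ (Fin d) → ℝ) : ℝ≥0∞ :=
  sInf {r | ∃ A, A ⊆ Om ∧ Admissible Om β A ∧ 0 < volW α A ∧ volW α A ≤ volW α Om / 2 ∧
    r = intBW Om α A / volW α A}

/-- `h̃_C`: boundary-measure constraint `|∂_E A|_β ≤ |∂Ω|_β/2`. -/
def hCt {d : ℕ} (Om : Set (EuclideanSpace ℝ (Fin d))) (α β : EuclideanSpace ℝ (Fin d) → ℝ) : ℝ≥0∞ :=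
  sInf {r | ∃ A, A ⊆ Om ∧ Admissible Om β A ∧ 0 < volW α A ∧
    extBW Om β A ≤ bdW Om β (frontier Om) / 2 ∧ r = intBW Om α A / volW α A}

/-- `h̄_C`: combined constraint `|A|_α + |∂_E A|_β ≤ 1/2`. -/
def hCb {d : ℕ} (Om : Set (EuclideanSpace ℝ (Fin d))) (α β : EuclideanSpace ℝ (Fin d) → ℝ) : ℝ≥0∞ :=
  sInf {r | ∃ A, A ⊆ Om ∧ Admissible Om β A ∧ 0 < volW α A ∧
    volW α A + extBW Om β A ≤ 1 / 2 ∧ r = intBW Om α A / volW α A}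

/-- `h_J`: Jammes constant with volume constraint. -/
def hJ {d : ℕ} (Om : Set (EuclideanSpace ℝ (Fin d))) (α β : EuclideanSpace ℝ (Fin d) → ℝ) : ℝ≥0∞ :=
  sInf {r | ∃ A, A ⊆ Om ∧ Admissible Om β A ∧ 0 < extBW Om β A ∧ volW α A ≤ volW α Om / 2 ∧
    r = intBW Om α A / extBW Om β A}

/-- `h̃_J`: Jammes constant with boundary-measure constraint. -/
def hJt {d : ℕ} (Om : Set (EuclideanSpace ℝ (Fin d))) (α β : EuclideanSpace ℝ (Fin d) → ℝ) : ℝ≥0∞ :=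
  sInf {r | ∃ A, A ⊆ Om ∧ Admissible Om β A ∧ 0 < extBW Om β A ∧
    extBW Om β A ≤ bdW Om β (frontier Om) / 2 ∧ r = intBW Om α A / extBW Om β A}

/-- `h̄_J`: Jammes constant with combined constraint. -/
def hJb {d : ℕ} (Om : Set (EuclideanSpace ℝ (Fin d))) (α β : EuclideanSpace ℝ (Fin d) → ℝ) : ℝ≥0∞ :=
  sInf {r | ∃ A, A ⊆ Om ∧ Admissible Om β A ∧ 0 < extBW Om β A ∧
    volW α A + extBW Om β A ≤ 1 / 2 ∧ r = intBW Om α A / extBW Om β A}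

/-- `h_B`: bulk-boundary constant with volume constraint. -/
def hB {d : ℕ} (Om : Set (EuclideanSpace ℝ (Fin d))) (α β : EuclideanSpace ℝ (Fin d) → ℝ) : ℝ≥0∞ :=
  sInf {r | ∃ A, A ⊆ Om ∧ Admissible Om β A ∧ 0 < volW α A + extBW Om β A ∧
    volW α A ≤ volW α Om / 2 ∧ r = intBW Om α A / (volW α A + extBW Om β A)}

/-- `h̃_B`: bulk-boundary constant with boundary-measure constraint. -/
def hBt {d : ℕ} (Om : Set (EuclideanSpace ℝ (Fin d))) (α β : EuclideanSpace ℝ (Fin d) → ℝ) : ℝ≥0∞ :=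
  sInf {r | ∃ A, A ⊆ Om ∧ Admissible Om β A ∧ 0 < volW α A + extBW Om β A ∧
    extBW Om β A ≤ bdW Om β (frontier Om) / 2 ∧ r = intBW Om α A / (volW α A + extBW Om β A)}

/-- `h̄_B`: bulk-boundary constant with combined constraint. -/
def hBb {d : ℕ} (Om : Set (EuclideanSpace ℝ (Fin d))) (α β : EuclideanSpace ℝ (Fin d) → ℝ) : ℝ≥0∞ :=
  sInf {r | ∃ A, A ⊆ Om ∧ Admissible Om β A ∧ 0 < volW α A + extBW Om β A ∧
    volW α A + extBW Om β A ≤ 1 / 2 ∧ r = intBW Om α A / (volW α A + extBW Om β A)}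

/-- `h̃_E`. -/
def hEt {d : ℕ} (Om : Set (EuclideanSpace ℝ (Fin d))) (α β : EuclideanSpace ℝ (Fin d) → ℝ) : ℝ≥0∞ :=
  sInf {r | ∃ B, B ⊆ Om ∧ Admissible Om β B ∧ 0 < volW α B + extBW Om β B ∧
    extBW Om β B ≤ bdW Om β (frontier Om) / 2 ∧
    r = (intBW Om α B + ddEW Om β B) / (volW α B + extBW Om β B)}

/-- `h̄_D`: Wentzell-type constant with combined constraints. -/
def hDb {d : ℕ} (Om : Set (EuclideanSpace ℝ (Fin d))) (α β : EuclideanSpace ℝ (Fin d) → ℝ) : ℝ≥0∞ :=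
  sInf {r | ∃ A B C, A ⊆ Om ∧ B ⊆ Om ∧ C ⊆ Om ∧
    Admissible Om β A ∧ Admissible Om β B ∧ Admissible Om β C ∧
    volW α A + extBW Om β A ≤ 1 / 2 ∧ volW α B + extBW Om β B ≤ 1 / 2 ∧
    volW α C + extBW Om β C ≤ 1 / 2 ∧
    0 < volW α A ∧ 0 < volW α B + extBW Om β B ∧ 0 < extBW Om β C ∧
    r = intBW Om α A / volW α A * (intBW Om α B / (volW α B + extBW Om β B)) +
        ddEW Om β B / (volW α B + extBW Om β B) * (ddEW Om β C / extBW Om β C)}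

/-- `h̃_D`: Wentzell-type constant with boundary-measure constraints. -/
def hDt {d : ℕ} (Om : Set (EuclideanSpace ℝ (Fin d))) (α β : EuclideanSpace ℝ (Fin d) → ℝ) : ℝ≥0∞ :=
  sInf {r | ∃ A B C, A ⊆ Om ∧ B ⊆ Om ∧ C ⊆ Om ∧
    Admissible Om β A ∧ Admissible Om β B ∧ Admissible Om β C ∧
    extBW Om β A ≤ bdW Om β (frontier Om) / 2 ∧ extBW Om β B ≤ bdW Om β (frontier Om) / 2 ∧
    extBW Om β C ≤ bdW Om β (frontier Om) / 2 ∧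
    0 < volW α A ∧ 0 < volW α B + extBW Om β B ∧ 0 < extBW Om β C ∧
    r = intBW Om α A / volW α A * (intBW Om α B / (volW α B + extBW Om β B)) +
        ddEW Om β B / (volW α B + extBW Om β B) * (ddEW Om β C / extBW Om β C)}

/-- Cheeger constant of the boundary `h_C(∂Ω)`. -/
def hCbd {d : ℕ} (Om : Set (EuclideanSpace ℝ (Fin d))) (β : EuclideanSpace ℝ (Fin d) → ℝ) : ℝ≥0∞ :=
  sInf {r | ∃ C, C ⊆ frontier Om ∧ MeasurableSet C ∧ 0 < bdW Om β C ∧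
    bdW Om β C ≤ bdW Om β (frontier Om) / 2 ∧
    r = wInt (Hm d ((d : ℝ) - 2)) β (relFrontier (frontier Om) C) / bdW Om β C}

/-- Tangential gradient `∇^τ f(x) = ∇f(x) - ⟨∇f(x), N(x)⟩ N(x)` with `N = ∇φ/‖∇φ‖`. -/
def tGrad {d : ℕ} (φ f : EuclideanSpace ℝ (Fin d) → ℝ) (x : EuclideanSpace ℝ (Fin d)) :
    EuclideanSpace ℝ (Fin d) :=
  gradient f x -
    (inner ℝ (gradient f x) ((‖gradient φ x‖)⁻¹ • gradient φ x) : ℝ) •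
      ((‖gradient φ x‖)⁻¹ • gradient φ x)

lemma intB_diff {d : ℕ} (Om A : Set (EuclideanSpace ℝ (Fin d))) :
    intB Om (Om \ A) = intB Om A := by
  unfold intB
  rw [← frontier_compl A, inter_comm, inter_comm (frontier Aᶜ), sdiff_eq, inter_comm Om,
    frontier_eq_closure_inter_closure, frontier_eq_closure_inter_closure]
  ext x
  have hnhds (hx : x ∈ interior Om) : ∀ᶠ y in nhds x, y ∈ Om := mem_interior_iff_mem_nhds.mp hx
  simp only [mem_inter_iff, mem_closure_iff_frequently, and_congr_right_iff]
  intro hx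
  refine and_congr ?_ ?_ <;> refine Filter.frequently_congr ?_ <;>
    filter_upwards [hnhds hx] with y hy <;> simp [hy]

lemma extBW_add_extBW_diff_le {d : ℕ} {Om A : Set (EuclideanSpace ℝ (Fin d))}
    {β : EuclideanSpace ℝ (Fin d) → ℝ} (hA : Admissible Om β A) :
    extBW Om β A + extBW Om β (Om \ A) ≤ bdW Om β (frontier Om) := by
  have hF : MeasurableSet (frontier Om) := isClosed_frontier.measurableSet
  have hE (B : Set (EuclideanSpace ℝ (Fin d))) : MeasurableSet (extB Om B) :=
    isClosed_closure.measurableSet.inter hF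
  have hbdW {S : Set (EuclideanSpace ℝ (Fin d))} (hS : MeasurableSet S) :
      bdW Om β S = (sigmaM d Om).withDensity (fun x => ENNReal.ofReal (β x)) S :=
    (withDensity_apply _ hS).symm
  have h0 : bdW Om β (extB Om A ∩ extB Om (Om \ A)) = 0 := by
    rw [← hA.2]
    congr 1
    exact (inter_inter_distrib_right _ _ _).symm
  rw [hbdW ((hE _).inter (hE _))] at h0
  unfold extBW
  rw [hbdW (hE _), hbdW (hE _), hbdW hF, ← measure_union_add_inter _ (hE (Om \ A)), h0, add_zero]
  exact measure_mono (union_subset inter_subset_right inter_subset_right)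

lemma volW_add_volW_diff {d : ℕ} {Om A : Set (EuclideanSpace ℝ (Fin d))}
    (α : EuclideanSpace ℝ (Fin d) → ℝ) (hA : MeasurableSet A) (hAO : A ⊆ Om) :
    volW α A + volW α (Om \ A) = volW α Om := by
  unfold volW wInt
  conv_rhs => rw [← lintegral_inter_add_sdiff _ Om hA, inter_eq_self_of_subset_right hAO]

lemma Admissible.diff {d : ℕ} {Om A : Set (EuclideanSpace ℝ (Fin d))}
    {β : EuclideanSpace ℝ (Fin d) → ℝ} (hA : Admissible Om β A) (hO : MeasurableSet Om)
    (hAO : A ⊆ Om) : Admissible Om β (Om \ A) := by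
  refine ⟨hO.diff hA.1, ?_⟩
  rw [sdiff_sdiff_cancel_left hAO, inter_comm (closure (Om \ A))]
  exact hA.2

theorem stmt_0 {d : ℕ} (hd : 2 ≤ d) (Om : Set (EuclideanSpace ℝ (Fin d)))
    (hOmc : IsCompact Om) (hOmi : (interior Om).Nonempty)
    (α β : EuclideanSpace ℝ (Fin d) → ℝ)
    (hαc : Continuous α) (hα0 : ∀ x, 0 ≤ α x)
    (hβc : Continuous β) (hβ0 : ∀ x, 0 ≤ β x)
    (hvol : 0 < volW α Om) (hbd : 0 < bdW Om β (frontier Om))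
    (hnorm : volW α Om + bdW Om β (frontier Om) = 1) :
    hCt Om α β ≤ hCb Om α β := by
  refine le_sInf ?_
  rintro r ⟨A, hAO, hA, hpos, hle, rfl⟩
  by_cases h : extBW Om β A ≤ bdW Om β (frontier Om) / 2
  · exact sInf_le ⟨A, hAO, hA, hpos, h, rfl⟩
  have hE := extBW_add_extBW_diff_le hA
  have hV := volW_add_volW_diff α hA.1 hAO
  obtain ⟨hVle, hEle⟩ : volW α A ≤ volW α (Om \ A) ∧
      extBW Om β (Om \ A) ≤ bdW Om β (frontier Om) / 2 := by
    generalize volW α (Om \ A) = a' at *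
    generalize extBW Om β (Om \ A) = e' at *
    generalize volW α A = a at *
    generalize extBW Om β A = e at *
    generalize volW α Om = v at *
    generalize bdW Om β (frontier Om) = b at *
    have hv : v ≠ ⊤ := by rintro rfl; simp at hnorm
    have hb : b ≠ ⊤ := by rintro rfl; simp at hnorm
    have ha : a ≠ ⊤ := by rintro rfl; simp at hV; exact hv hV.symm
    have ha' : a' ≠ ⊤ := by rintro rfl; simp at hV; exact hv hV.symm
    have he : e ≠ ⊤ := by rintro rfl; simp at hE; exact hb hE
    have he' : e' ≠ ⊤ := by rintro rfl; simp at hE; exact hb hE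
    lift v to NNReal using hv
    lift b to NNReal using hb
    lift a to NNReal using ha
    lift a' to NNReal using ha'
    lift e to NNReal using he
    lift e' to NNReal using he'
    have h2 : (2 : ℝ≥0∞) = ((2 : NNReal) : ℝ≥0∞) := rfl
    rw [h2, ← ENNReal.coe_div two_ne_zero] at h
    rw [h2, ← ENNReal.coe_one, ← ENNReal.coe_div two_ne_zero] at hle
    rw [h2, ← ENNReal.coe_div two_ne_zero]
    norm_cast at *
    rw [← NNReal.coe_le_coe] at *
    rw [← NNReal.coe_inj] at hnorm hV
    push_cast at *
    constructor <;> linarith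
  calc hCt Om α β ≤ intBW Om α (Om \ A) / volW α (Om \ A) :=
        sInf_le ⟨Om \ A, sdiff_subset, hA.diff hOmc.measurableSet hAO, hpos.trans_le hVle, hEle, rfl⟩
    _ ≤ intBW Om α A / volW α A := by
        rw [intBW, intB_diff]
        exact ENNReal.div_le_div_left hVle _
end
end

section
/- The bulk-boundary Cheeger-type constant satisfies the lower bound h_B ≥ min(h_C, h_J)/2. -/
open MeasureTheory Set ENNReal

noncomputable section

/-- A lower bound `m` for the ratios `I / V` and `I / E` (whenever the denominator is positive)
yields the lower bound `m / 2` for `I / (V + E)`. -/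
theorem half_le_div_add {m I V E : ℝ≥0∞} (hV : 0 < V → m ≤ I / V) (hE : 0 < E → m ≤ I / E)
    (h0 : V + E ≠ 0) (ht : V + E ≠ ∞) : m / 2 ≤ I / (V + E) := by
  have key : ∀ X : ℝ≥0∞, (0 < X → m ≤ I / X) → m * X ≤ I := by
    intro X hX
    rcases eq_zero_or_pos X with rfl | hpos
    · simp
    · exact ENNReal.mul_le_of_le_div (hX hpos)
  rw [ENNReal.le_div_iff_mul_le (Or.inl h0) (Or.inl ht), ← ENNReal.mul_div_right_comm]
  refine ENNReal.div_le_of_le_mul ?_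
  rw [mul_add, mul_two]
  exact add_le_add (key V hV) (key E hE)

theorem stmt_6 {d : ℕ} (hd : 2 ≤ d) (Om : Set (EuclideanSpace ℝ (Fin d)))
    (hOmc : IsCompact Om) (hOmi : (interior Om).Nonempty)
    (α β : EuclideanSpace ℝ (Fin d) → ℝ)
    (hαc : Continuous α) (hα0 : ∀ x, 0 ≤ α x)
    (hβc : Continuous β) (hβ0 : ∀ x, 0 ≤ β x)
    (hvol : 0 < volW α Om) (hbd : 0 < bdW Om β (frontier Om))
    (hnorm : volW α Om + bdW Om β (frontier Om) = 1) :
    min (hC Om α β) (hJ Om α β) / 2 ≤ hB Om α β := by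
  have hVol : volW α Om ≠ ∞ := ne_top_of_le_ne_top one_ne_top (hnorm ▸ le_self_add)
  have hBd : bdW Om β (frontier Om) ≠ ∞ := ne_top_of_le_ne_top one_ne_top (hnorm ▸ le_add_self)
  refine le_sInf ?_
  rintro r ⟨A, hA, hadm, hpos, hhalf, rfl⟩
  have hV : volW α A ≠ ∞ := ne_top_of_le_ne_top hVol (lintegral_mono_set hA)
  have hE : extBW Om β A ≠ ∞ := ne_top_of_le_ne_top hBd (lintegral_mono_set inter_subset_right)
  exact half_le_div_add
    (fun h => (min_le_left _ _).trans (sInf_le ⟨A, hA, hadm, h, hhalf, rfl⟩))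
    (fun h => (min_le_right _ _).trans (sInf_le ⟨A, hA, hadm, h, hhalf, rfl⟩))
    hpos.ne' (ENNReal.add_ne_top.2 ⟨hV, hE⟩)
end
end

section
/- For the boundary-constraint Cheeger-type constants it holds that h̃_B ≤ h̃_C, h̃_B ≤ h̃_J, and h̃_B ≥ min(h̃_C, h̃_J)/2. -/
open MeasureTheory Set ENNReal

noncomputable section

/-- A lower bound for `p / v` (if `v > 0`) and `p / e` (if `e > 0`), halved, bounds
`p / (v + e)` from below. -/
theorem half_le_div_add_s8 {m p v e : ℝ≥0∞} (hpos : 0 < v + e) (hfin : v + e ≠ ⊤)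
    (hv : 0 < v → m ≤ p / v) (he : 0 < e → m ≤ p / e) : m / 2 ≤ p / (v + e) := by
  have mul_le {x : ℝ≥0∞} (hx : 0 < x → m ≤ p / x) : m * x ≤ p := by
    rcases eq_or_ne x 0 with rfl | h0
    · simp
    · exact ENNReal.mul_le_of_le_div (hx (pos_iff_ne_zero.mpr h0))
  rw [ENNReal.le_div_iff_mul_le (Or.inl hpos.ne') (Or.inl hfin)]
  calc m / 2 * (v + e) = (m * v + m * e) / 2 := by
        rw [ENNReal.mul_comm_div, mul_div_assoc', mul_add]
    _ ≤ (p + p) / 2 := by gcongr; exacts [mul_le hv, mul_le he]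
    _ = p := by rw [ENNReal.add_div, ENNReal.add_halves]

theorem stmt_8 {d : ℕ} (hd : 2 ≤ d) (Om : Set (EuclideanSpace ℝ (Fin d)))
    (hOmc : IsCompact Om) (hOmi : (interior Om).Nonempty)
    (α β : EuclideanSpace ℝ (Fin d) → ℝ)
    (hαc : Continuous α) (hα0 : ∀ x, 0 ≤ α x)
    (hβc : Continuous β) (hβ0 : ∀ x, 0 ≤ β x)
    (hvol : 0 < volW α Om) (hbd : 0 < bdW Om β (frontier Om))
    (hnorm : volW α Om + bdW Om β (frontier Om) = 1) :
    hBt Om α β ≤ hCt Om α β ∧ hBt Om α β ≤ hJt Om α β ∧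
      min (hCt Om α β) (hJt Om α β) / 2 ≤ hBt Om α β := by
  refine ⟨le_sInf ?_, le_sInf ?_, le_sInf ?_⟩
  · rintro r ⟨A, hA, hadm, hpos, hle, rfl⟩
    calc hBt Om α β ≤ intBW Om α A / (volW α A + extBW Om β A) :=
          sInf_le ⟨A, hA, hadm, hpos.trans_le le_self_add, hle, rfl⟩
      _ ≤ intBW Om α A / volW α A := ENNReal.div_le_div_left le_self_add _
  · rintro r ⟨A, hA, hadm, hpos, hle, rfl⟩
    calc hBt Om α β ≤ intBW Om α A / (volW α A + extBW Om β A) :=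
          sInf_le ⟨A, hA, hadm, hpos.trans_le le_add_self, hle, rfl⟩
      _ ≤ intBW Om α A / extBW Om β A := ENNReal.div_le_div_left le_add_self _
  · rintro r ⟨A, hA, hadm, hpos, hle, rfl⟩
    have hfin : volW α A + extBW Om β A ≠ ⊤ := by
      refine ne_top_of_le_ne_top one_ne_top (hnorm ▸ add_le_add ?_ ?_)
      · exact lintegral_mono_set hA
      · exact lintegral_mono_set inter_subset_right
    refine half_le_div_add_s8 hpos hfin (fun hv => ?_) (fun he => ?_)
    · exact (min_le_left _ _).trans (sInf_le ⟨A, hA, hadm, hv, hle, rfl⟩)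
    · exact (min_le_right _ _).trans (sInf_le ⟨A, hA, hadm, he, hle, rfl⟩)
end
end

section
/- If h_C > 0, h̃_J > 0, and there exists a constant c > 0 such that every admissible set A ⊆ Ω with |A|_α > |Ω|_α/2 satisfies |∂_I A|_α + |∂_E A|_β ≥ c, then h̃_C > 0. -/
open MeasureTheory Set ENNReal

noncomputable section

theorem stmt_9 {d : ℕ} (hd : 2 ≤ d) (Om : Set (EuclideanSpace ℝ (Fin d)))
    (hOmc : IsCompact Om) (hOmi : (interior Om).Nonempty)
    (α β : EuclideanSpace ℝ (Fin d) → ℝ)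
    (hαc : Continuous α) (hα0 : ∀ x, 0 ≤ α x)
    (hβc : Continuous β) (hβ0 : ∀ x, 0 ≤ β x)
    (hvol : 0 < volW α Om) (hbd : 0 < bdW Om β (frontier Om))
    (hnorm : volW α Om + bdW Om β (frontier Om) = 1)
    (hhC : 0 < hC Om α β) (hhJt : 0 < hJt Om α β)
    (hiso : ∃ c : ℝ≥0∞, 0 < c ∧ ∀ A, A ⊆ Om → Admissible Om β A →
      volW α Om / 2 < volW α A → c ≤ intBW Om α A + extBW Om β A) :
    0 < hCt Om α β := by
  obtain ⟨c, hc, hiso⟩ := hiso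
  have hk : 0 < min 1 (hJt Om α β) := lt_min one_pos hhJt
  refine lt_of_lt_of_le
    (lt_min hhC (ENNReal.div_pos (ENNReal.mul_pos hk.ne' hc.ne').ne' ENNReal.ofNat_ne_top :
      0 < min 1 (hJt Om α β) * c / 2)) (le_sInf ?_)
  rintro _ ⟨A, hA, hadm, hpos, hE, rfl⟩
  rcases le_or_gt (volW α A) (volW α Om / 2) with hV | hV
  · exact (min_le_left _ _).trans (sInf_le ⟨A, hA, hadm, hpos, hV, rfl⟩)
  have hV1 : volW α A ≤ 1 :=
    (lintegral_mono_set hA).trans (le_self_add.trans hnorm.le)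
  have hfin : extBW Om β A ≠ ∞ :=
    ne_top_of_le_ne_top ENNReal.one_ne_top
      (hE.trans (ENNReal.half_le_self.trans (le_add_self.trans hnorm.le)))
  have hIE : min 1 (hJt Om α β) * extBW Om β A ≤ intBW Om α A := by
    rcases eq_or_ne (extBW Om β A) 0 with h0 | h0
    · simp [h0]
    · rw [← ENNReal.le_div_iff_mul_le (Or.inl h0) (Or.inl hfin)]
      exact (min_le_right _ _).trans
        (sInf_le ⟨A, hA, hadm, pos_iff_ne_zero.2 h0, hE, rfl⟩)
  calc min (hC Om α β) (min 1 (hJt Om α β) * c / 2)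
      ≤ min 1 (hJt Om α β) * c / 2 := min_le_right _ _
    _ ≤ intBW Om α A := by
      refine ENNReal.div_le_of_le_mul ?_
      calc min 1 (hJt Om α β) * c
          ≤ min 1 (hJt Om α β) * (intBW Om α A + extBW Om β A) := by
            gcongr
            exact hiso A hA hadm hV
        _ ≤ intBW Om α A + intBW Om α A := by
            rw [mul_add]
            exact add_le_add (mul_le_of_le_one_left' (min_le_left _ _)) hIE
        _ = intBW Om α A * 2 := (mul_two _).symm
    _ ≤ intBW Om α A / volW α A := by
      simpa using ENNReal.div_le_div_left hV1 (intBW Om α A)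
end
end

section
/- Coarea lower bound for the Dirichlet energy of a nonnegative function in terms of Cheeger-type constants: let f : ℝ^d → ℝ be continuous and nonnegative, continuously differentiable on a neighborhood of Ω, and for t > 0 set D_t := { x ∈ Ω : f(x)² ≥ t }. Suppose that for every t > 0 the set D_t is admissible and satisfies |D_t|_α + |∂_E D_t|_β ≤ 1/2, and suppose the coarea identities ∫_Ω ‖∇(f²)‖ α dλ = ∫_0^∞ |∂_I D_t|_α dt and ∫_{∂Ω} f² β dσ = ∫_0^∞ |∂_E D_t|_β dt hold. Then ( ∫_Ω ‖∇(f²)‖ α dλ )² ≥ h̄_B · h̄_C · ( ∫_Ω f² α dλ + ∫_{∂Ω} f² β dσ ) · ∫_Ω f² α dλ. -/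
open MeasureTheory Set ENNReal

noncomputable section

theorem lintegral_mul_eq_lintegral_setLIntegral_superlevel {X : Type*} [MeasurableSpace X]
    (μ : Measure X) (w : X → ℝ) (hw : Measurable w) (g : X → ℝ) (hg : Measurable g)
    (hg0 : ∀ x, 0 ≤ g x) (S : Set X) :
    ∫⁻ x in S, ENNReal.ofReal (g x * w x) ∂μ =
      ∫⁻ t in Set.Ioi (0 : ℝ), ∫⁻ x in {x ∈ S | t ≤ g x}, ENNReal.ofReal (w x) ∂μ := by
  have h := lintegral_eq_lintegral_meas_le
    ((μ.restrict S).withDensity fun x => ENNReal.ofReal (w x))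
    (Filter.Eventually.of_forall hg0) hg.aemeasurable
  rw [lintegral_withDensity_eq_lintegral_mul _ hw.ennreal_ofReal hg.ennreal_ofReal] at h
  calc ∫⁻ x in S, ENNReal.ofReal (g x * w x) ∂μ
      = ∫⁻ x in S, ((fun x => ENNReal.ofReal (w x)) * fun x => ENNReal.ofReal (g x)) x ∂μ := by
        simp only [Pi.mul_apply, ENNReal.ofReal_mul (hg0 _), mul_comm (ENNReal.ofReal (w _))]
    _ = _ := h
    _ = _ := by
        refine lintegral_congr fun t => ?_
        have ht : MeasurableSet {x | t ≤ g x} := measurableSet_le measurable_const hg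
        rw [withDensity_apply _ ht, Measure.restrict_restrict ht, Set.inter_comm]
        rfl

theorem hCb_mul_volW_le_intBW {d : ℕ} {Om A : Set (EuclideanSpace ℝ (Fin d))}
    {α β : EuclideanSpace ℝ (Fin d) → ℝ} (hA : A ⊆ Om) (hadm : Admissible Om β A)
    (hle : volW α A + extBW Om β A ≤ 1 / 2) :
    hCb Om α β * volW α A ≤ intBW Om α A := by
  rcases eq_or_ne (volW α A) 0 with h0 | h0
  · simp [h0]
  have hfin : volW α A ≠ ∞ :=
    ((le_self_add.trans hle).trans_lt (by simp)).ne
  rw [← ENNReal.le_div_iff_mul_le (.inl h0) (.inl hfin)]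
  exact sInf_le ⟨A, hA, hadm, h0.bot_lt, hle, rfl⟩

theorem hBb_mul_add_le_intBW {d : ℕ} {Om A : Set (EuclideanSpace ℝ (Fin d))}
    {α β : EuclideanSpace ℝ (Fin d) → ℝ} (hA : A ⊆ Om) (hadm : Admissible Om β A)
    (hle : volW α A + extBW Om β A ≤ 1 / 2) :
    hBb Om α β * (volW α A + extBW Om β A) ≤ intBW Om α A := by
  rcases eq_or_ne (volW α A + extBW Om β A) 0 with h0 | h0
  · rw [h0, mul_zero]
    exact zero_le
  have hfin : volW α A + extBW Om β A ≠ ∞ := (hle.trans_lt (by simp)).ne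
  rw [← ENNReal.le_div_iff_mul_le (.inl h0) (.inl hfin)]
  exact sInf_le ⟨A, hA, hadm, h0.bot_lt, hle, rfl⟩

theorem stmt_18 {d : ℕ} (hd : 2 ≤ d) (Om : Set (EuclideanSpace ℝ (Fin d)))
    (hOmc : IsCompact Om) (hOmi : (interior Om).Nonempty)
    (α β : EuclideanSpace ℝ (Fin d) → ℝ)
    (hαc : Continuous α) (hα0 : ∀ x, 0 ≤ α x)
    (hβc : Continuous β) (hβ0 : ∀ x, 0 ≤ β x)
    (hvol : 0 < volW α Om) (hbd : 0 < bdW Om β (frontier Om))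
    (hnorm : volW α Om + bdW Om β (frontier Om) = 1)
    (f : EuclideanSpace ℝ (Fin d) → ℝ) (hfc : Continuous f) (hf0 : ∀ x, 0 ≤ f x)
    (hf1 : ∃ U, IsOpen U ∧ Om ⊆ U ∧ ContDiffOn ℝ 1 f U)
    (hadm : ∀ t > (0 : ℝ), Admissible Om β {x ∈ Om | t ≤ f x ^ 2} ∧
      volW α {x ∈ Om | t ≤ f x ^ 2} + extBW Om β {x ∈ Om | t ≤ f x ^ 2} ≤ 1 / 2)
    (hcoarea1 : wInt volume (fun x => ‖gradient (fun y => f y ^ 2) x‖ * α x) Om =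
      ∫⁻ t in Set.Ioi (0 : ℝ), intBW Om α {x ∈ Om | t ≤ f x ^ 2})
    (hcoarea2 : wInt (sigmaM d Om) (fun x => f x ^ 2 * β x) (frontier Om) =
      ∫⁻ t in Set.Ioi (0 : ℝ), extBW Om β {x ∈ Om | t ≤ f x ^ 2}) :
    (wInt volume (fun x => ‖gradient (fun y => f y ^ 2) x‖ * α x) Om) ^ 2 ≥
      hBb Om α β * hCb Om α β *
        ((wInt volume (fun x => f x ^ 2 * α x) Om +
        wInt (sigmaM d Om) (fun x => f x ^ 2 * β x) (frontier Om)) *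
          wInt volume (fun x => f x ^ 2 * α x) Om) := by
  have hlayer : wInt volume (fun x => f x ^ 2 * α x) Om =
      ∫⁻ t in Set.Ioi (0 : ℝ), volW α {x ∈ Om | t ≤ f x ^ 2} :=
    lintegral_mul_eq_lintegral_setLIntegral_superlevel volume α hαc.measurable
      (fun x => f x ^ 2) (hfc.pow 2).measurable (fun x => sq_nonneg _) Om
  have hC_le : hCb Om α β * wInt volume (fun x => f x ^ 2 * α x) Om ≤
      wInt volume (fun x => ‖gradient (fun y => f y ^ 2) x‖ * α x) Om := by
    rw [hlayer, hcoarea1]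
    refine (lintegral_const_mul_le _ _).trans (setLIntegral_mono' measurableSet_Ioi fun t ht => ?_)
    exact hCb_mul_volW_le_intBW (Set.sep_subset _ _) (hadm t ht).1 (hadm t ht).2
  have hB_le : hBb Om α β * (wInt volume (fun x => f x ^ 2 * α x) Om +
        wInt (sigmaM d Om) (fun x => f x ^ 2 * β x) (frontier Om)) ≤
      wInt volume (fun x => ‖gradient (fun y => f y ^ 2) x‖ * α x) Om := by
    rw [hlayer, hcoarea1, hcoarea2]
    refine (mul_le_mul_right (le_lintegral_add _ _) _).trans
      ((lintegral_const_mul_le _ _).trans (setLIntegral_mono' measurableSet_Ioi fun t ht => ?_))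
    exact hBb_mul_add_le_intBW (Set.sep_subset _ _) (hadm t ht).1 (hadm t ht).2
  rw [ge_iff_le, mul_mul_mul_comm, sq]
  exact mul_le_mul' hB_le hC_le
end
end
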